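/- arXiv:2507.07516 — 3 statements merged into one kernel-verified Lean document; each statement's English description precedes it below -/
import Mathlib

section
/- Let n be an odd positive integer and let ∼ be an equivalence relation on ℤ/nℤ with the property that for all i, j ∈ ℤ/nℤ, either (i ∼ j and i+1 ∼ j+1) or (i ∼ j+1 and i+1 ∼ j). Then i ∼ 0 for every i ∈ ℤ/nℤ. -/
/-- Let `n` be an odd positive integer and `r` an equivalence relation on
`ℤ/nℤ` such that for all `i j`, either (`i ∼ j` and `i+1 ∼ j+1`) or (`i ∼ j+1` and
`i+1 ∼ j`). Then `i ∼ 0` for every `i`. -/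
theorem odd_circle (n : ℕ) (hodd : Odd n) (hpos : 0 < n)
    (r : ZMod n → ZMod n → Prop) (hequiv : Equivalence r)
    (h : ∀ i j : ZMod n, (r i j ∧ r (i + 1) (j + 1)) ∨ (r i (j + 1) ∧ r (i + 1) j)) :
    ∀ i : ZMod n, r i 0 := by
  have step : ∀ i : ZMod n, r i (i + 2) := fun i ↦ by
    rw [← one_add_one_eq_two, ← add_assoc]
    rcases h i (i + 1) with ⟨h₁, h₂⟩ | ⟨h₁, -⟩
    · exact hequiv.trans h₁ h₂
    · exact h₁
  have even : ∀ m : ℕ, r (2 * (m : ZMod n)) 0 := fun m ↦ by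
    induction m with
    | zero => simpa using hequiv.refl 0
    | succ m ih =>
      rw [Nat.cast_succ, mul_add_one]
      exact hequiv.trans (hequiv.symm (step _)) ih
  intro i
  have : NeZero n := ⟨hpos.ne'⟩
  obtain ⟨k, hk⟩ := hodd
  have hn : 2 * (k : ZMod n) + 1 = 0 := by
    simpa [-CharP.cast_eq_zero] using
      (congrArg (Nat.cast : ℕ → ZMod n) hk).symm.trans (ZMod.natCast_self n)
  have hi : i = 2 * (((k + 1) * i.val : ℕ) : ZMod n) := by
    push_cast
    rw [ZMod.natCast_zmod_val]
    linear_combination -i * hn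
  rw [hi]
  exact even _
end

section
/- Let R' be a finitely generated free ℤ-module equipped with a negative definite symmetric bilinear form such that no vector v ∈ R' satisfies v·v = −1. If δ, δ' ∈ R' satisfy δ·δ = δ'·δ' = −2 and δ − δ' ∈ 2R', then δ = δ' or δ = −δ'. Consequently, any set of vectors of square −2 in R' containing no pair {v, −v} maps injectively to R'/2R'. -/
/-- In a negative definite lattice with no vector of square `-1`, two vectors of square `-2` whose
difference is divisible by `2` agree up to sign. -/
theorem eq_or_eq_neg_of_sub_eq_add_self {M : Type*} [AddCommGroup M] [Module ℤ M]
    (B : M →ₗ[ℤ] M →ₗ[ℤ] ℤ) (hsymm : ∀ x y : M, B x y = B y x)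
    (hneg : ∀ v : M, v ≠ 0 → B v v < 0) (hnoMinusOne : ∀ v : M, B v v ≠ -1)
    {x y w : M} (hx : B x x = -2) (hy : B y y = -2) (hw : x - y = w + w) :
    x = y ∨ x = -y := by
  obtain rfl : y = x - (w + w) := by rw [← hw]; abel
  by_cases hw0 : w = 0
  · left; simp [hw0]
  by_cases hxw : x - w = 0
  · right; rw [sub_eq_zero.mp hxw]; abel
  have h₁ := hneg w hw0
  have h₂ := hneg (x - w) hxw
  have h₃ := hnoMinusOne w
  have h₄ := hnoMinusOne (x - w)
  simp only [map_sub, map_add, LinearMap.sub_apply, LinearMap.add_apply, hsymm w x] at hy h₂ h₄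
  omega

/-- Let `R'` be a finitely generated free ℤ-module with a negative definite
symmetric bilinear form containing no vector of square `-1`. If `δ, δ'` have square `-2`
and `δ - δ' ∈ 2R'`, then `δ = δ'` or `δ = -δ'`. Consequently, any set of square `-2`
vectors containing no pair `{v, -v}` maps injectively to `R'/2R'`. -/
theorem roots_mod2_injective (R' : Type*) [AddCommGroup R'] [Module ℤ R']
    [Module.Free ℤ R'] [Module.Finite ℤ R']
    (B : R' →ₗ[ℤ] R' →ₗ[ℤ] ℤ)
    (hsymm : ∀ x y : R', B x y = B y x)
    (hneg : ∀ v : R', v ≠ 0 → B v v < 0)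
    (hnoMinusOne : ∀ v : R', B v v ≠ -1) :
    (∀ δ δ' : R', B δ δ = -2 → B δ' δ' = -2 → (∃ w : R', δ - δ' = 2 • w) →
      δ = δ' ∨ δ = -δ') ∧
    (∀ S : Set R', (∀ v ∈ S, B v v = -2) → (∀ v ∈ S, -v ∉ S) →
      Set.InjOn
        (fun v : R' =>
          (Submodule.Quotient.mk v :
            R' ⧸ LinearMap.range ((2 : ℤ) • (LinearMap.id : R' →ₗ[ℤ] R'))))
        S) := by
  refine ⟨fun δ δ' hδ hδ' ⟨w, hw⟩ => ?_, fun S hS hSneg v hv u hu hvu => ?_⟩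
  · exact eq_or_eq_neg_of_sub_eq_add_self B hsymm hneg hnoMinusOne hδ hδ'
      (hw.trans (two_smul _ w))
  · obtain ⟨w, hw⟩ := (Submodule.Quotient.eq _).mp hvu
    have hw' : v - u = w + w := by
      rw [← hw, two_smul, LinearMap.add_apply, LinearMap.id_apply]
    rcases eq_or_eq_neg_of_sub_eq_add_self B hsymm hneg hnoMinusOne (hS v hv) (hS u hu) hw'
      with h | h
    · exact h
    · exact absurd (h ▸ hv) (hSneg u hu)
end

section
/- Let (V, q) be a regular quadratic space over F₂ and W ⊆ V a subspace. Let K_b = W ∩ W^⊥ be the radical of the bilinear form restricted to W, and K_q = {x ∈ K_b : q(x) = 0} the radical of the quadratic form on W. Set w = dim W^⊥, n = dim K_b, k = dim K_q. Then q induces a well-defined quadratic form on the quotient W^⊥/K_q, and the pointwise stabilizer of W in O(V) has order #O(W^⊥/K_q) · 2^e, where e = n(n−1)/2 + k(w−n) + n − k. -/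
namespace BinaryQuadraticForm

open QuadraticMap

section

variable {V : Type*} [AddCommGroup V] [Module (ZMod 2) V] {Q : QuadraticForm (ZMod 2) V}

theorem eq_zero_or_eq_one (c : ZMod 2) : c = 0 ∨ c = 1 := by
  decide +revert

theorem exists_polar_eq [FiniteDimensional (ZMod 2) V]
    (hreg : LinearMap.BilinForm.Nondegenerate (polarBilin Q))
    (f : Module.Dual (ZMod 2) V) : ∃ v, ∀ x, polar Q v x = f x :=
  ⟨(LinearMap.BilinForm.toDual _ hreg).symm f, fun x =>
    LinearMap.BilinForm.apply_toDual_symm_apply (hB := hreg) f x⟩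

theorem eq_zero_of_polar_eq_zero (hreg : LinearMap.BilinForm.Nondegenerate (polarBilin Q))
    {x : V} (hx : ∀ y, polar Q x y = 0) : x = 0 :=
  hreg.1 x hx

theorem exists_polar_eq_one [FiniteDimensional (ZMod 2) V]
    (hreg : LinearMap.BilinForm.Nondegenerate (polarBilin Q))
    {T : Submodule (ZMod 2) V} {x : V} (hx : x ∉ T) :
    ∃ c, (∀ h ∈ T, polar Q h c = 0) ∧ polar Q x c = 1 := by
  obtain ⟨f, hfx, hfT⟩ := Submodule.exists_le_ker_of_notMem hx
  obtain ⟨c, hc⟩ := exists_polar_eq hreg f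
  refine ⟨c, fun h hh => ?_, ?_⟩
  · rw [polar_comm, hc]
    exact hfT hh
  · rw [polar_comm, hc]
    exact (eq_zero_or_eq_one _).resolve_left hfx

theorem polar_map_of_map_eq {V' : Type*} [AddCommGroup V'] [Module (ZMod 2) V']
    {Q' : QuadraticForm (ZMod 2) V'} {f : V →ₗ[ZMod 2] V'} {x y : V}
    (hx : Q' (f x) = Q x) (hy : Q' (f y) = Q y) (hxy : Q' (f (x + y)) = Q (x + y)) :
    polar Q' (f x) (f y) = polar Q x y := by
  simp only [polar, hx, hy, hxy, ← map_add]

theorem polar_isometryEquiv {V' : Type*} [AddCommGroup V'] [Module (ZMod 2) V']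
    {Q' : QuadraticForm (ZMod 2) V'} (g : Q.IsometryEquiv Q') (x y : V) :
    polar Q' (g x) (g y) = polar Q x y := by
  simp only [polar, IsometryEquiv.map_app, ← map_add]

/-- A linear endomorphism preserving a regular quadratic form, as a self-isometry. -/
noncomputable def isometryOfLinearMap [FiniteDimensional (ZMod 2) V]
    (hreg : LinearMap.BilinForm.Nondegenerate (polarBilin Q))
    (f : V →ₗ[ZMod 2] V) (hf : ∀ x, Q (f x) = Q x) : Q.IsometryEquiv Q where
  toLinearEquiv := LinearEquiv.ofInjectiveEndo f <| (injective_iff_map_eq_zero f).2 fun x hx =>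
    eq_zero_of_polar_eq_zero hreg fun y => by
      rw [← polar_map_of_map_eq (hf x) (hf y) (hf _), hx, polar_zero_left]
  map_app' := hf

@[simp]
theorem isometryOfLinearMap_apply [FiniteDimensional (ZMod 2) V]
    (hreg : LinearMap.BilinForm.Nondegenerate (polarBilin Q))
    (f : V →ₗ[ZMod 2] V) (hf : ∀ x, Q (f x) = Q x) (x : V) :
    isometryOfLinearMap hreg f hf x = f x :=
  rfl

theorem map_smul_zmod_two (c : ZMod 2) (x : V) : Q (c • x) = c * Q x := by
  rw [QuadraticMap.map_smul, smul_eq_mul]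
  congr 1
  decide +revert

/-- Transitivity of the pointwise stabilizer of `T`, realized by reflections and Siegel
transvections. -/
theorem exists_isometryEquiv_fixing [FiniteDimensional (ZMod 2) V]
    (hreg : LinearMap.BilinForm.Nondegenerate (polarBilin Q))
    {T : Submodule (ZMod 2) V} {x y : V} (hxT : x ∉ T) (hyT : y ∉ T) (hxy : Q x = Q y)
    (hT : ∀ h ∈ T, polar Q h x = polar Q h y) :
    ∃ τ : Q.IsometryEquiv Q, (∀ h ∈ T, τ h = h) ∧ τ x = y := by
  have hxx : polar Q x x = 0 := by
    rw [polar_self, two_smul, CharTwo.add_self_eq_zero]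
  have hTa : ∀ h ∈ T, polar Q h (x + y) = 0 := fun h hh => by
    rw [polar_add_right, hT h hh, CharTwo.add_self_eq_zero]
  have hQa : Q (x + y) = polar Q x y := by
    rw [QuadraticMap.map_add Q, hxy, CharTwo.add_self_eq_zero, zero_add]
  have hxa : polar Q x (x + y) = polar Q x y := by rw [polar_add_right, hxx, zero_add]
  have hxay : x + (x + y) = y := by rw [← add_assoc, ZModModule.add_self, zero_add]
  generalize x + y = a at *
  obtain hb | hb := (eq_zero_or_eq_one (polar Q x y)).symm
  · refine ⟨isometryOfLinearMap hreg
      (LinearMap.id + ((polarBilin Q).flip a).smulRight a) fun v => ?_, ?_, ?_⟩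
    · simp only [LinearMap.add_apply, LinearMap.id_apply, LinearMap.smulRight_apply,
        LinearMap.flip_apply, polarBilin_apply_apply, QuadraticMap.map_add Q v,
        map_smul_zmod_two, polar_smul_right, hQa, hb, smul_eq_mul]
      generalize polar Q v a = s
      generalize Q v = r
      decide +revert
    · intro h hh
      simp [hTa h hh]
    · simp [hxa, hb, hxay]
  · have hxa' : x ∉ T ⊔ Submodule.span (ZMod 2) {a} := by
      rw [Submodule.mem_sup]
      rintro ⟨h, hh, z, hz, hhz⟩
      obtain ⟨c, rfl⟩ := Submodule.mem_span_singleton.1 hz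
      obtain rfl | rfl := eq_zero_or_eq_one c
      · rw [zero_smul, add_zero] at hhz
        exact hxT (hhz ▸ hh)
      · refine hyT ?_
        have : h = y := by
          rw [one_smul] at hhz
          rw [← hxay, ← hhz, add_assoc, ZModModule.add_self, add_zero]
        exact this ▸ hh
    obtain ⟨c, hc, hxc⟩ := exists_polar_eq_one hreg hxa'
    have hac : polar Q c a = 0 := by
      rw [polar_comm]
      exact hc _ (Submodule.mem_sup_right (Submodule.mem_span_singleton_self _))
    refine ⟨isometryOfLinearMap hreg
      (LinearMap.id + ((polarBilin Q).flip a).smulRight c +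
        ((polarBilin Q).flip c + Q c • (polarBilin Q).flip a).smulRight a)
        fun v => ?_, ?_, ?_⟩
    · simp only [LinearMap.add_apply, LinearMap.id_apply, LinearMap.smulRight_apply,
        LinearMap.flip_apply, polarBilin_apply_apply, LinearMap.smul_apply]
      rw [QuadraticMap.map_add Q, QuadraticMap.map_add Q v]
      simp only [map_smul_zmod_two, polar_smul_right, polar_smul_left, polar_add_left Q v,
        hQa, hb, hac, smul_eq_mul]
      generalize polar Q v a = s
      generalize polar Q v c = t
      generalize Q v = r
      generalize Q c = u
      decide +revert
    · intro h hh
      simp [hTa h hh, hc h (Submodule.mem_sup_left hh)]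
    · simp [hxa, hb, hxc, hxay]

/-- **Witt's extension theorem** over the field with two elements. -/
theorem exists_isometryEquiv_extending [FiniteDimensional (ZMod 2) V]
    (hreg : LinearMap.BilinForm.Nondegenerate (polarBilin Q)) (S : Submodule (ZMod 2) V)
    (f : V →ₗ[ZMod 2] V) (hQ : ∀ x ∈ S, Q (f x) = Q x) (hinj : ∀ x ∈ S, f x = 0 → x = 0) :
    ∃ g : Q.IsometryEquiv Q, ∀ x ∈ S, g x = f x := by
  classical
  obtain ⟨s, rfl⟩ := IsNoetherian.noetherian S
  induction s using Finset.induction_on with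
  | empty =>
    refine ⟨QuadraticMap.IsometryEquiv.refl Q, fun x hx => ?_⟩
    simp only [Finset.coe_empty, Submodule.span_empty, Submodule.mem_bot] at hx
    simp [hx]
  | insert a s _ ih =>
    have hle : Submodule.span (ZMod 2) (s : Set V) ≤
        Submodule.span (ZMod 2) ((insert a s : Finset V) : Set V) :=
      Submodule.span_mono (by simp)
    have ha : a ∈ Submodule.span (ZMod 2) ((insert a s : Finset V) : Set V) :=
      Submodule.subset_span (by simp)
    obtain ⟨g, hg⟩ := ih (fun x hx => hQ x (hle hx)) (fun x hx => hinj x (hle hx))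
    by_cases haT : a ∈ Submodule.span (ZMod 2) (s : Set V)
    · refine ⟨g, fun x hx => hg x ?_⟩
      rwa [Finset.coe_insert, Submodule.span_insert_eq_span haT] at hx
    have hgs : ∀ z, g (g.symm z) = z := g.toLinearEquiv.apply_symm_apply
    have hsg : ∀ z, g.symm (g z) = z := g.toLinearEquiv.symm_apply_apply
    obtain ⟨τ, hτ, hτa⟩ := exists_isometryEquiv_fixing hreg haT (y := g.symm (f a))
      (fun hmem => by
        have h1 := hg _ hmem
        rw [hgs, ← sub_eq_zero, ← map_sub] at h1
        have h2 := hinj _ (Submodule.sub_mem _ ha (hle hmem)) h1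
        rw [sub_eq_zero] at h2
        exact haT (h2 ▸ hmem))
      (by rw [IsometryEquiv.map_app, hQ a ha])
      (fun h hh => by
        rw [← polar_map_of_map_eq (hQ h (hle hh)) (hQ a ha)
          (hQ _ (Submodule.add_mem _ (hle hh) ha)), ← polar_isometryEquiv g h, hgs, hg h hh])
    refine ⟨τ.trans g, fun x hx => ?_⟩
    rw [Finset.coe_insert, Submodule.mem_span_insert] at hx
    obtain ⟨c, z, hz, rfl⟩ := hx
    change g (τ (c • a + z)) = _
    rw [map_add, map_smul, hτa, hτ z hz, map_add, map_smul, hgs, hg z hz, map_add, map_smul]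

end

section

variable {ι : Type*} [Fintype ι] [DecidableEq ι]

open Matrix

theorem forall_mulVec_dotProduct_eq_zero_iff (a : Matrix ι ι (ZMod 2)) (c : ι → ZMod 2) :
    (∀ t : ι → ZMod 2, a *ᵥ t ⬝ᵥ c + a *ᵥ t ⬝ᵥ t = 0) ↔
      (∀ i j, a i j = a j i) ∧ ∀ j, a j j = (fun i => a i j) ⬝ᵥ c := by
  have hadd : ∀ s t : ι → ZMod 2, a *ᵥ (s + t) ⬝ᵥ c + a *ᵥ (s + t) ⬝ᵥ (s + t) =
      (a *ᵥ s ⬝ᵥ c + a *ᵥ s ⬝ᵥ s) + (a *ᵥ t ⬝ᵥ c + a *ᵥ t ⬝ᵥ t) +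
        (a *ᵥ s ⬝ᵥ t + a *ᵥ t ⬝ᵥ s) := fun s t => by
    simp only [mulVec_add, add_dotProduct, dotProduct_add]
    ring
  have hsingle : ∀ j, a *ᵥ Pi.single j 1 = fun i => a i j := fun j => by
    ext i
    simp
  constructor
  · intro h
    have hpol : ∀ s t : ι → ZMod 2, a *ᵥ s ⬝ᵥ t + a *ᵥ t ⬝ᵥ s = 0 := fun s t => by
      simpa only [h, zero_add] using (hadd s t).symm
    refine ⟨fun i j => ?_, fun j => ?_⟩
    · have := hpol (Pi.single j 1) (Pi.single i 1)
      rw [hsingle, hsingle, dotProduct_single_one, dotProduct_single_one] at this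
      exact CharTwo.add_eq_zero.1 this
    · have := h (Pi.single j 1)
      rw [hsingle, dotProduct_single_one] at this
      exact (CharTwo.add_eq_zero.1 this).symm
  · rintro ⟨hsymm, hdiag⟩
    have hpol : ∀ s t : ι → ZMod 2, a *ᵥ s ⬝ᵥ t + a *ᵥ t ⬝ᵥ s = 0 := fun s t => by
      have ha : aᵀ = a := by
        ext i j
        exact hsymm j i
      rw [dotProduct_comm (a *ᵥ t), dotProduct_mulVec, ← mulVec_transpose, ha,
        CharTwo.add_self_eq_zero]
    let Φ : (ι → ZMod 2) →+ ZMod 2 :=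
      AddMonoidHom.mk' (fun t => a *ᵥ t ⬝ᵥ c + a *ᵥ t ⬝ᵥ t) fun s t => by
        simp only [hadd, hpol, add_zero]
    have hΦ : Φ = 0 := AddMonoidHom.functions_ext _ _ _ fun j x => by
      obtain rfl | rfl := eq_zero_or_eq_one x
      · simp
      · change a *ᵥ Pi.single j 1 ⬝ᵥ c + a *ᵥ Pi.single j 1 ⬝ᵥ Pi.single j 1 = 0
        rw [hsingle, dotProduct_single_one, ← hdiag, CharTwo.add_self_eq_zero]
    exact fun t => DFunLike.congr_fun hΦ t

theorem natCard_sym2_notDiag_fun :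
    Nat.card ({z : Sym2 ι // ¬z.IsDiag} → ZMod 2) = 2 ^ (Fintype.card ι).choose 2 := by
  rw [Nat.card_fun, Nat.card_zmod, Nat.card_eq_fintype_card, Sym2.card_subtype_not_diag]

theorem natCard_alternating_matrix :
    Nat.card {a : Matrix ι ι (ZMod 2) //
      (∀ i j, a i j = a j i) ∧ ∀ j, a j j = (fun i => a i j) ⬝ᵥ (0 : ι → ZMod 2)} =
      2 ^ (Fintype.card ι).choose 2 := by
  rw [← natCard_sym2_notDiag_fun]
  refine Nat.card_eq_of_bijective
    (fun a z => Sym2.lift ⟨a.1, a.2.1⟩ z.1) ⟨fun a b hab => ?_, fun f => ?_⟩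
  · ext i j
    by_cases hij : i = j
    · subst hij
      rw [a.2.2, b.2.2, dotProduct_zero, dotProduct_zero]
    · exact congrFun hab ⟨s(i, j), by simpa using hij⟩
  · refine ⟨⟨fun i j => if h : s(i, j).IsDiag then 0 else f ⟨s(i, j), h⟩, fun i j => ?_,
      fun j => by simp⟩, ?_⟩
    · simp only [Sym2.eq_swap (a := i)]
    · ext ⟨z, hz⟩
      induction z with | _ i j =>
        have hij : i ≠ j := by simpa using hz
        simp [hij]

theorem natCard_symmetric_matrix_single (i₀ : ι) :
    Nat.card {a : Matrix ι ι (ZMod 2) //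
      (∀ i j, a i j = a j i) ∧ ∀ j, a j j = (fun i => a i j) ⬝ᵥ Pi.single i₀ 1} =
      2 ^ ((Fintype.card ι).choose 2 + 1) := by
  have h : Nat.card (({z : Sym2 ι // ¬z.IsDiag} → ZMod 2) × ZMod 2) =
      2 ^ ((Fintype.card ι).choose 2 + 1) := by
    rw [Nat.card_prod, natCard_sym2_notDiag_fun, Nat.card_zmod, pow_succ]
  rw [← h]
  simp only [dotProduct_single_one]
  refine Nat.card_eq_of_bijective
    (fun a => (fun z => Sym2.lift ⟨a.1, a.2.1⟩ z.1, a.1 i₀ i₀)) ⟨fun a b hab => ?_, ?_⟩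
  · have hne : ∀ i j, i ≠ j → a.1 i j = b.1 i j := fun i j hij =>
      congrFun (congrArg Prod.fst hab) ⟨s(i, j), by simpa using hij⟩
    ext i j
    by_cases hij : i = j
    · subst hij
      by_cases hi : i₀ = i
      · subst hi
        exact congrArg Prod.snd hab
      · rw [a.2.2, b.2.2, hne _ _ hi]
    · exact hne i j hij
  · rintro ⟨f, t⟩
    let d : ι → ι → ZMod 2 := fun i j => if h : s(i, j).IsDiag then t else f ⟨s(i, j), h⟩
    have hd : ∀ i j, d i j = d j i := fun i j => by simp only [d, Sym2.eq_swap (a := i)]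
    refine ⟨⟨fun i j => if i = j then d i₀ j else d i j, fun i j => ?_, fun j => ?_⟩, ?_⟩
    · by_cases hij : i = j
      · simp [hij]
      · simp [hij, Ne.symm hij, hd i j]
    · by_cases hj : i₀ = j <;> simp [hj]
    · refine Prod.ext ?_ (by simp [d])
      ext ⟨z, hz⟩
      induction z with | _ i j =>
        have hij : i ≠ j := by simpa using hz
        simp [hij, d]

end

section

variable {V : Type*} [AddCommGroup V] [Module (ZMod 2) V] {Q : QuadraticForm (ZMod 2) V}

theorem exists_linearMap_eq {K : Submodule (ZMod 2) V}
    (hK : ∀ x ∈ K, ∀ y ∈ K, polar Q x y = 0) :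
    ∃ l : K →ₗ[ZMod 2] ZMod 2, ∀ x : K, l x = Q x :=
  ⟨{ toFun x := Q x
     map_add' x y := by
      rw [Submodule.coe_add, QuadraticMap.map_add Q, hK x x.2 y y.2, add_zero]
     map_smul' c x := map_smul_zmod_two c (x : V) }, fun _ => rfl⟩

open Matrix in
theorem natCard_fixing_eq_natCard_matrix [FiniteDimensional (ZMod 2) V]
    (hreg : LinearMap.BilinForm.Nondegenerate (polarBilin Q)) {Y K : Submodule (ZMod 2) V}
    (hK : ∀ x, x ∈ K ↔ ∀ y ∈ Y, polar Q y x = 0) (hKY : K ≤ Y)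
    {ι : Type*} [Fintype ι] [DecidableEq ι] (e : Module.Basis ι (ZMod 2) K) (c : ι → ZMod 2)
    (hc : ∀ i, Q (e i) = c i) :
    Nat.card {g : Q.IsometryEquiv Q // ∀ x ∈ Y, g x = x} =
      Nat.card {a : Matrix ι ι (ZMod 2) //
        (∀ i j, a i j = a j i) ∧ ∀ j, a j j = (fun i => a i j) ⬝ᵥ c} := by
  have hKK : ∀ x ∈ K, ∀ y ∈ K, polar Q x y = 0 := fun x hx y hy => (hK y).1 hy x (hKY hx)
  obtain ⟨l, hl⟩ := exists_linearMap_eq hKK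
  let t : V →ₗ[ZMod 2] ι → ZMod 2 := LinearMap.pi fun i => polarBilin Q (e i)
  have ht : ∀ x i, t x i = polar Q (e i) x := fun x i => rfl
  have htY : ∀ y ∈ Y, t y = 0 := fun y hy => by
    ext i
    rw [ht, polar_comm]
    exact (hK _).1 (e i).2 y hy
  have htsurj : ∀ s, ∃ x, t x = s := fun s => by
    obtain ⟨f, hf⟩ := LinearMap.exists_extend (e.constr (ZMod 2) s)
    obtain ⟨x, hx⟩ := exists_polar_eq hreg f
    refine ⟨x, funext fun i => ?_⟩
    rw [ht, polar_comm, hx]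
    simpa using DFunLike.congr_fun hf (e i)
  let φ : Matrix ι ι (ZMod 2) → V →ₗ[ZMod 2] V := fun a =>
    K.subtype ∘ₗ e.equivFun.symm.toLinearMap ∘ₗ a.mulVecLin ∘ₗ t
  have hφ : ∀ a x, φ a x = (e.equivFun.symm (a *ᵥ t x) : K) := fun a x => rfl
  have hQφ : ∀ a x, Q (φ a x) = a *ᵥ t x ⬝ᵥ c := fun a x => by
    rw [hφ, ← hl, Module.Basis.equivFun_symm_apply, map_sum]
    simp [hl, hc, dotProduct, map_smul_zmod_two]
  have hpolφ : ∀ a x, polar Q x (φ a x) = a *ᵥ t x ⬝ᵥ t x := fun a x => by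
    rw [hφ, Module.Basis.equivFun_symm_apply, Submodule.coe_sum, ← polarBilin_apply_apply, map_sum]
    simp [dotProduct, ht, polar_comm Q x]
  have hQ : ∀ a, (∀ x, Q ((LinearMap.id + φ a : V →ₗ[ZMod 2] V) x) = Q x) ↔
      (∀ i j, a i j = a j i) ∧ ∀ j, a j j = (fun i => a i j) ⬝ᵥ c := fun a => by
    rw [← forall_mulVec_dotProduct_eq_zero_iff]
    have : ∀ x, Q ((LinearMap.id + φ a : V →ₗ[ZMod 2] V) x) = Q x ↔
        a *ᵥ t x ⬝ᵥ c + a *ᵥ t x ⬝ᵥ t x = 0 :=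
      fun x => by
        rw [LinearMap.add_apply, LinearMap.id_apply, QuadraticMap.map_add Q, hQφ, hpolφ, add_assoc,
          add_eq_left]
    simp only [this]
    exact ⟨fun h s => by obtain ⟨x, rfl⟩ := htsurj s; exact h x, fun h x => h _⟩
  symm
  refine Nat.card_eq_of_bijective (fun a => ⟨isometryOfLinearMap hreg (LinearMap.id + φ a.1)
    ((hQ a.1).2 a.2), fun x hx => ?_⟩) ⟨fun a b hab => ?_, fun g => ?_⟩
  · simp [hφ, htY x hx]
  · have hab' : ∀ s, a.1 *ᵥ s = b.1 *ᵥ s := fun s => by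
      obtain ⟨x, rfl⟩ := htsurj s
      have := DFunLike.congr_fun (congrArg Subtype.val hab) x
      simp only [isometryOfLinearMap_apply, LinearMap.add_apply, add_right_inj, hφ] at this
      exact e.equivFun.symm.injective (Subtype.ext this)
    ext i j
    simpa using congrFun (hab' (Pi.single j 1)) i
  · have hgK : ∀ x, g.1 x - x ∈ K := fun x => (hK _).2 fun y hy => by
      have := polar_isometryEquiv g.1 y x
      rw [g.2 y hy] at this
      rw [polar_sub_right, this, sub_self]
    let ψ : V →ₗ[ZMod 2] K :=
      (g.1.toLinearEquiv.toLinearMap - LinearMap.id).codRestrict K hgK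
    have hψ : ∀ x, (ψ x : V) = g.1 x - x := fun x => rfl
    have hrow : ∀ i, ∃ r : ι → ZMod 2, ∀ x, e.equivFun (ψ x) i = r ⬝ᵥ t x := fun i => by
      obtain ⟨v, hv⟩ := exists_polar_eq hreg
        (LinearMap.proj i ∘ₗ e.equivFun.toLinearMap ∘ₗ ψ)
      have hvK : v ∈ K := (hK v).2 fun y hy => by
        have : ψ y = 0 := Subtype.ext (by rw [hψ, g.2 y hy, sub_self]; rfl)
        rw [polar_comm, hv]
        simp [this]
      refine ⟨e.equivFun ⟨v, hvK⟩, fun x => ?_⟩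
      have hv' : v = ∑ j, e.equivFun ⟨v, hvK⟩ j • (e j : V) := by
        have := congrArg Subtype.val (e.sum_equivFun ⟨v, hvK⟩)
        rw [Submodule.coe_sum] at this
        exact this.symm
      have h1 : e.equivFun (ψ x) i = polarBilin Q v x := (hv x).symm
      rw [h1]
      conv_lhs => rw [hv']
      rw [map_sum, LinearMap.sum_apply]
      simp [dotProduct, ht]
    obtain ⟨a, ha⟩ : ∃ a : Matrix ι ι (ZMod 2), ∀ i x, e.equivFun (ψ x) i = a i ⬝ᵥ t x := by
      choose a ha using hrow
      exact ⟨Matrix.of a, ha⟩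
    have hga : ∀ x, g.1 x = (LinearMap.id + φ a : V →ₗ[ZMod 2] V) x := fun x => by
      have : a *ᵥ t x = e.equivFun (ψ x) := funext fun i => (ha i x).symm
      rw [LinearMap.add_apply, hφ, this, LinearEquiv.symm_apply_apply, hψ, LinearMap.id_apply,
        add_sub_cancel]
    refine ⟨⟨a, (hQ a).1 fun x => ?_⟩, Subtype.ext (DFunLike.ext _ _ fun x => (hga x).symm)⟩
    rw [← hga, IsometryEquiv.map_app]

theorem natCard_fixing [FiniteDimensional (ZMod 2) V]
    (hreg : LinearMap.BilinForm.Nondegenerate (polarBilin Q)) {Y K Kq : Submodule (ZMod 2) V}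
    (hK : ∀ x, x ∈ K ↔ ∀ y ∈ Y, polar Q y x = 0) (hKY : K ≤ Y)
    (hKq : ∀ x, x ∈ Kq ↔ x ∈ K ∧ Q x = 0) :
    Nat.card {g : Q.IsometryEquiv Q // ∀ x ∈ Y, g x = x} =
      2 ^ (Module.finrank (ZMod 2) K * (Module.finrank (ZMod 2) K - 1) / 2 +
        (Module.finrank (ZMod 2) K - Module.finrank (ZMod 2) Kq)) := by
  have hKK : ∀ x ∈ K, ∀ y ∈ K, polar Q x y = 0 := fun x hx y hy => (hK y).1 hy x (hKY hx)
  obtain ⟨l, hl⟩ := exists_linearMap_eq hKK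
  have hker : Module.finrank (ZMod 2) Kq = Module.finrank (ZMod 2) (LinearMap.ker l) := by
    have : Kq = (LinearMap.ker l).map K.subtype := by
      ext x
      simp [hKq, hl, and_comm]
    rw [this, Submodule.finrank_map_subtype_eq]
  rw [← Nat.choose_two_right, hker]
  by_cases h0 : l = 0
  · have e := Module.finBasis (ZMod 2) K
    rw [natCard_fixing_eq_natCard_matrix hreg hK hKY e 0 (fun i => by simp [← hl, h0]),
      natCard_alternating_matrix, Fintype.card_fin, h0, LinearMap.ker_zero, finrank_top,
      Nat.sub_self, add_zero]
  · obtain ⟨y, hy⟩ : ∃ y, l y = 1 := by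
      by_contra! h
      exact h0 (LinearMap.ext fun y => (eq_zero_or_eq_one (l y)).resolve_right (h y))
    let e := Module.Basis.mkFinCons y (Module.finBasis (ZMod 2) (LinearMap.ker l))
      (fun c x hx h => by simpa [hy, LinearMap.mem_ker.1 hx] using congrArg l h)
      (fun z => ⟨l z, by simp [hy, CharTwo.add_self_eq_zero]⟩)
    have hcard : Module.finrank (ZMod 2) K = Module.finrank (ZMod 2) (LinearMap.ker l) + 1 := by
      simpa using Module.finrank_eq_card_basis e
    rw [natCard_fixing_eq_natCard_matrix hreg hK hKY e (Pi.single 0 1) (fun i => ?_),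
      natCard_symmetric_matrix_single, Fintype.card_fin, hcard, Nat.add_sub_cancel_left]
    rw [← hl, Module.Basis.coe_mkFinCons]
    refine Fin.cases ?_ (fun i => ?_) i
    · simp [hy]
    · simp

end

section

theorem natCard_eq_mul_of_natCard_fiber {α β : Type*} [Finite α] [Finite β] (f : α → β) {c : ℕ}
    (h : ∀ b, Nat.card {a // f a = b} = c) : Nat.card α = Nat.card β * c := by
  cases nonempty_fintype β
  rw [← Nat.card_congr (Equiv.sigmaFiberEquiv f), Nat.card_sigma]
  simp [h]

theorem exists_linearMap_extending_both {F V V' : Type*} [Field F] [AddCommGroup V] [Module F V]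
    [AddCommGroup V'] [Module F V'] {S T : Submodule F V} (f : S →ₗ[F] V') (g : T →ₗ[F] V')
    (h : ∀ (x : S) (y : T), (x : V) = y → f x = g y) :
    ∃ r : V →ₗ[F] V', (∀ x : S, r x = f x) ∧ ∀ y : T, r y = g y := by
  let f' : V →ₗ.[F] V' := ⟨S, f⟩
  let g' : V →ₗ.[F] V' := ⟨T, g⟩
  obtain ⟨r, hr⟩ := LinearMap.exists_extend (f'.sup g' h).toFun
  refine ⟨r, fun x => ?_, fun y => ?_⟩
  · exact (DFunLike.congr_fun hr ⟨x, Submodule.mem_sup_left x.2⟩).trans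
      ((LinearPMap.left_le_sup f' g' h).2 rfl).symm
  · exact (DFunLike.congr_fun hr ⟨y, Submodule.mem_sup_right y.2⟩).trans
      ((LinearPMap.right_le_sup f' g' h).2 rfl).symm

theorem mkQ_eq_zero_iff {R M : Type*} [Ring R] [AddCommGroup M] [Module R M] (N : Submodule R M)
    {x : M} : N.mkQ x = 0 ↔ x ∈ N :=
  Submodule.Quotient.mk_eq_zero N

theorem natCard_lifts {U : Type*} [AddCommGroup U] [Module (ZMod 2) U]
    [FiniteDimensional (ZMod 2) U] (K N : Submodule (ZMod 2) U)
    (h : U ⧸ N →ₗ[ZMod 2] U ⧸ N) (hK : ∀ x ∈ K, h (N.mkQ x) = N.mkQ x) :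
    Nat.card {f : U →ₗ[ZMod 2] U // (∀ x ∈ K, f x = x) ∧ ∀ u, N.mkQ (f u) = h (N.mkQ u)} =
      2 ^ (Module.finrank (ZMod 2) N *
        (Module.finrank (ZMod 2) U - Module.finrank (ZMod 2) K)) := by
  obtain ⟨f₀, hf₀K, hf₀⟩ : ∃ f₀ : U →ₗ[ZMod 2] U,
      (∀ x ∈ K, f₀ x = x) ∧ ∀ u, N.mkQ (f₀ u) = h (N.mkQ u) := by
    obtain ⟨s, hs⟩ := LinearMap.exists_rightInverse_of_surjective N.mkQ N.range_mkQ
    have hs' : ∀ x, N.mkQ (s x) = x := DFunLike.congr_fun hs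
    obtain ⟨D, hD⟩ := LinearMap.exists_extend
      (((LinearMap.id - s ∘ₗ h ∘ₗ N.mkQ) ∘ₗ K.subtype).codRestrict N fun x => by
        change (x : U) - s (h (N.mkQ x)) ∈ N
        rw [← mkQ_eq_zero_iff, map_sub, hs', hK x x.2, sub_self])
    refine ⟨s ∘ₗ h ∘ₗ N.mkQ + N.subtype ∘ₗ D, fun x hx => ?_, fun u => ?_⟩
    · have : (D x : U) = x - s (h (N.mkQ x)) :=
        congrArg Subtype.val (DFunLike.congr_fun hD ⟨x, hx⟩)
      change s (h (N.mkQ x)) + (D x : U) = x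
      rw [this, add_sub_cancel]
    · change N.mkQ (s (h (N.mkQ u)) + (D u : U)) = _
      have : N.mkQ (D u : U) = 0 := (mkQ_eq_zero_iff N).2 (D u).2
      rw [map_add, hs', this, add_zero]
  have hcard : Nat.card ((U ⧸ K) →ₗ[ZMod 2] N) = 2 ^ (Module.finrank (ZMod 2) N *
      (Module.finrank (ZMod 2) U - Module.finrank (ZMod 2) K)) := by
    rw [Module.natCard_eq_pow_finrank (K := ZMod 2), Nat.card_zmod, Module.finrank_linearMap,
      Submodule.finrank_quotient, mul_comm]
  rw [← hcard]
  symm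
  refine Nat.card_eq_of_bijective
    (fun ψ => ⟨f₀ + N.subtype ∘ₗ ψ ∘ₗ K.mkQ, fun x hx => ?_, fun u => ?_⟩)
    ⟨fun ψ ψ' hψ => ?_, fun f => ?_⟩
  · have : K.mkQ x = 0 := (mkQ_eq_zero_iff K).2 hx
    simp only [LinearMap.add_apply, LinearMap.comp_apply, this, map_zero, add_zero, hf₀K x hx]
  · have : N.mkQ (ψ (K.mkQ u) : U) = 0 := (mkQ_eq_zero_iff N).2 (ψ _).2
    change N.mkQ (f₀ u + (ψ (K.mkQ u) : U)) = _
    rw [map_add, this, add_zero, hf₀]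
  · have := add_left_cancel (congrArg Subtype.val hψ)
    refine LinearMap.ext fun z => ?_
    obtain ⟨u, rfl⟩ := K.mkQ_surjective z
    exact Subtype.ext (DFunLike.congr_fun this u)
  · have hmem : ∀ u, (f.1 - f₀) u ∈ N := fun u => by
      rw [← mkQ_eq_zero_iff, LinearMap.sub_apply, map_sub, f.2.2, hf₀,
        sub_self]
    refine ⟨K.liftQ ((f.1 - f₀).codRestrict N hmem) fun x hx => ?_, ?_⟩
    · refine LinearMap.mem_ker.2 (Subtype.ext ?_)
      change f.1 x - f₀ x = 0
      rw [f.2.1 x hx, hf₀K x hx, sub_self]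
    · refine Subtype.ext (LinearMap.ext fun u => ?_)
      change f₀ u + (f.1 u - f₀ u) = f.1 u
      rw [add_sub_cancel]

end

section

variable {V : Type*} [AddCommGroup V] [Module (ZMod 2) V] {Q : QuadraticForm (ZMod 2) V}

theorem exists_quotient_form (N : Submodule (ZMod 2) V) (hQ : ∀ z ∈ N, Q z = 0)
    (hN : ∀ z ∈ N, ∀ x, polar Q x z = 0) :
    ∃ Q' : QuadraticForm (ZMod 2) (V ⧸ N), ∀ x, Q' (N.mkQ x) = Q x := by
  obtain ⟨s, hs⟩ := LinearMap.exists_rightInverse_of_surjective N.mkQ N.range_mkQ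
  refine ⟨Q.comp s, fun x => ?_⟩
  have hmem : s (N.mkQ x) - x ∈ N := by
    rw [← mkQ_eq_zero_iff, map_sub, sub_eq_zero]
    exact DFunLike.congr_fun hs (N.mkQ x)
  rw [comp_apply, ← add_sub_cancel x (s (N.mkQ x)), QuadraticMap.map_add Q, hQ _ hmem,
    hN _ hmem, add_zero, add_zero]

instance [FiniteDimensional (ZMod 2) V] : Finite (Q.IsometryEquiv Q) :=
  have : Finite V := Module.finite_of_finite (ZMod 2)
  DFunLike.finite _

/-- Restriction from `W`-fixing isometries of `V` to isometries of `U = W^⊥` fixing `W ⊓ U`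
is onto, with all fibers of the size of the pointwise stabilizer of `W ⊔ U`. -/
theorem natCard_stabilizer_eq_mul [FiniteDimensional (ZMod 2) V]
    (hreg : LinearMap.BilinForm.Nondegenerate (polarBilin Q)) {W U : Submodule (ZMod 2) V}
    (hU : ∀ x, x ∈ U ↔ ∀ y ∈ W, polar Q y x = 0)
    (hW : ∀ x, x ∈ W ↔ ∀ y ∈ U, polar Q y x = 0) :
    Nat.card {g : Q.IsometryEquiv Q // ∀ x ∈ W, g x = x} =
      Nat.card {f : U →ₗ[ZMod 2] U // (∀ x : U, Q (f x) = Q x) ∧ ∀ x : U, (x : V) ∈ W → f x = x} *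
        Nat.card {g : Q.IsometryEquiv Q // ∀ x ∈ W ⊔ U, g x = x} := by
  have : Finite U := Module.finite_of_finite (ZMod 2)
  have : Finite (U →ₗ[ZMod 2] U) := DFunLike.finite _
  have hmem : ∀ g : {g : Q.IsometryEquiv Q // ∀ x ∈ W, g x = x}, ∀ x : U, g.1 x ∈ U :=
    fun g x => (hU _).2 fun y hy => by
      rw [← g.2 y hy, polar_isometryEquiv]
      exact (hU _).1 x.2 y hy
  refine natCard_eq_mul_of_natCard_fiber
    (fun g => ⟨(g.1.toLinearEquiv.toLinearMap ∘ₗ U.subtype).codRestrict U (hmem g),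
      fun x => g.1.map_app x, fun x hx => Subtype.ext (g.2 x hx)⟩) fun f => ?_
  obtain ⟨F, hFW, hFU⟩ := exists_linearMap_extending_both W.subtype (U.subtype ∘ₗ f.1)
    fun x y hxy => by
      change (x : V) = f.1 y
      rw [f.2.2 y (hxy ▸ x.2), hxy]
  have hFW' : ∀ w ∈ W, F w = w := fun w hw => hFW ⟨w, hw⟩
  have hFU' : ∀ u (hu : u ∈ U), F u = f.1 ⟨u, hu⟩ := fun u hu => hFU ⟨u, hu⟩
  have hFQ : ∀ x ∈ W ⊔ U, Q (F x) = Q x := fun x hx => by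
    obtain ⟨w, hw, u, hu, rfl⟩ := Submodule.mem_sup.1 hx
    rw [map_add, hFW' w hw, hFU' u hu, QuadraticMap.map_add Q, QuadraticMap.map_add Q w, f.2.1,
      (hU _).1 (f.1 _).2 w hw, (hU _).1 hu w hw]
  obtain ⟨g₀, hg₀⟩ := exists_isometryEquiv_extending hreg (W ⊔ U) F hFQ fun x hx h0 => by
    have hperp : ∀ y ∈ W ⊔ U, polar Q y x = 0 := fun y hy => by
      rw [← polar_map_of_map_eq (hFQ y hy) (hFQ x hx) (hFQ _ (Submodule.add_mem _ hy hx)), h0,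
        polar_zero_right]
    rw [← hFW' x ((hW x).2 fun y hy => hperp y (Submodule.mem_sup_right hy)), h0]
  have hgs : ∀ z, g₀ (g₀.symm z) = z := g₀.toLinearEquiv.apply_symm_apply
  have hsg : ∀ z, g₀.symm (g₀ z) = z := g₀.toLinearEquiv.symm_apply_apply
  have hg₀W : ∀ w ∈ W, g₀ w = w := fun w hw => by
    rw [hg₀ w (Submodule.mem_sup_left hw), hFW' w hw]
  have hg₀U : ∀ u (hu : u ∈ U), g₀ u = f.1 ⟨u, hu⟩ := fun u hu => by
    rw [hg₀ u (Submodule.mem_sup_right hu), hFU' u hu]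
  symm
  refine Nat.card_eq_of_bijective
    (fun m => ⟨⟨m.1.trans g₀, fun x hx => ?_⟩, Subtype.ext (LinearMap.ext fun u =>
      Subtype.ext ?_)⟩) ⟨fun m m' hm => ?_, fun g => ?_⟩
  · change g₀ (m.1 x) = x
    rw [m.2 x (Submodule.mem_sup_left hx), hg₀W x hx]
  · change g₀ (m.1 u) = _
    rw [m.2 u (Submodule.mem_sup_right u.2), hg₀U u u.2]
  · refine Subtype.ext (DFunLike.ext _ _ fun x => ?_)
    have := DFunLike.congr_fun (congrArg Subtype.val (congrArg Subtype.val hm)) x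
    exact g₀.toLinearEquiv.injective this
  · have hgU : ∀ u (hu : u ∈ U), g.1.1 u = f.1 ⟨u, hu⟩ := fun u hu =>
      congrArg (fun r => (r.1 ⟨u, hu⟩ : V)) g.2
    refine ⟨⟨g.1.1.trans g₀.symm, fun x hx => ?_⟩, ?_⟩
    · obtain ⟨w, hw, u, hu, rfl⟩ := Submodule.mem_sup.1 hx
      change g₀.symm (g.1.1 (w + u)) = w + u
      rw [map_add, g.1.2 w hw, hgU u hu, ← hg₀U u hu, ← hsg (w + u), map_add g₀, hg₀W w hw]
    · exact Subtype.ext (Subtype.ext (DFunLike.ext _ _ fun x => hgs (g.1.1 x)))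

theorem natCard_isometry_fixing_radical [FiniteDimensional (ZMod 2) V] {K N : Submodule (ZMod 2) V}
    (hK : ∀ x, x ∈ K ↔ ∀ y, polar Q y x = 0) (hN : ∀ x, x ∈ N ↔ x ∈ K ∧ Q x = 0)
    {Q' : QuadraticForm (ZMod 2) (V ⧸ N)} (hQ' : ∀ x, Q' (N.mkQ x) = Q x) :
    Nat.card {f : V →ₗ[ZMod 2] V // (∀ x, Q (f x) = Q x) ∧ ∀ x ∈ K, f x = x} =
      Nat.card (Q'.IsometryEquiv Q') * 2 ^ (Module.finrank (ZMod 2) N *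
        (Module.finrank (ZMod 2) V - Module.finrank (ZMod 2) K)) := by
  have hmk : ∀ x, N.mkQ x = 0 ↔ x ∈ N := fun x => mkQ_eq_zero_iff N
  have hpolar : ∀ x y, polar Q' (N.mkQ x) (N.mkQ y) = polar Q x y := fun x y =>
    polar_map_of_map_eq (hQ' x) (hQ' y) (hQ' _)
  have hfix : ∀ h : Q'.IsometryEquiv Q', ∀ x ∈ K, h (N.mkQ x) = N.mkQ x := fun h x hx => by
    obtain ⟨y, hy⟩ := N.mkQ_surjective (h (N.mkQ x))
    have hyK : y ∈ K := (hK y).2 fun z => by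
      obtain ⟨z', hz'⟩ := h.toLinearEquiv.surjective (N.mkQ z)
      obtain ⟨v, rfl⟩ := N.mkQ_surjective z'
      rw [← hpolar, hy, ← hz']
      exact (polar_isometryEquiv h _ _).trans ((hpolar v x).trans ((hK x).1 hx v))
    have hQy : Q y = Q x := by rw [← hQ', hy, IsometryEquiv.map_app, hQ']
    rw [← hy, ← sub_eq_zero, ← map_sub, hmk, hN]
    refine ⟨K.sub_mem hyK hx, ?_⟩
    rw [ZModModule.sub_eq_add, QuadraticMap.map_add Q, hQy, (hK x).1 hx, add_zero,
      CharTwo.add_self_eq_zero]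
  let Lift := fun h : Q'.IsometryEquiv Q' => {f : V →ₗ[ZMod 2] V //
    (∀ x ∈ K, f x = x) ∧ ∀ u, N.mkQ (f u) = h.toLinearEquiv.toLinearMap (N.mkQ u)}
  have : Finite V := Module.finite_of_finite (ZMod 2)
  have : Finite (V →ₗ[ZMod 2] V) := DFunLike.finite _
  have hcard : Nat.card (Σ h, Lift h) = Nat.card (Q'.IsometryEquiv Q') *
      2 ^ (Module.finrank (ZMod 2) N *
        (Module.finrank (ZMod 2) V - Module.finrank (ZMod 2) K)) := by
    cases nonempty_fintype (Q'.IsometryEquiv Q')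
    rw [Nat.card_sigma]
    simp only [Lift, natCard_lifts K N _ (hfix _)]
    simp
  rw [← hcard]
  symm
  refine Nat.card_eq_of_bijective (fun p => ⟨p.2.1, fun x => ?_, p.2.2.1⟩)
    ⟨fun p p' hp => ?_, fun f => ?_⟩
  · rw [← hQ', p.2.2.2, ← hQ' x]
    exact p.1.map_app _
  · obtain ⟨h, f, hf⟩ := p
    obtain ⟨h', f', hf'⟩ := p'
    obtain rfl : f = f' := congrArg Subtype.val hp
    obtain rfl : h = h' := DFunLike.ext _ _ fun z => by
      obtain ⟨u, rfl⟩ := N.mkQ_surjective z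
      exact (hf.2 u).symm.trans (hf'.2 u)
    rfl
  · have hinj : ∀ x, f.1 x = 0 → x = 0 := fun x hx => by
      have hxK : x ∈ K := (hK x).2 fun y => by
        rw [← polar_map_of_map_eq (f.2.1 y) (f.2.1 x) (f.2.1 _), hx, polar_zero_right]
      rw [← f.2.2 x hxK, hx]
    have hNle : N ≤ N.comap f.1 := fun x hx => by
      rwa [Submodule.mem_comap, f.2.2 x ((hN x).1 hx).1]
    let h : Q'.IsometryEquiv Q' :=
      { toLinearEquiv := LinearEquiv.ofInjectiveEndo (N.mapQ N f.1 hNle) <|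
          (injective_iff_map_eq_zero _).2 fun z hz => by
            obtain ⟨u, rfl⟩ := N.mkQ_surjective z
            have hfu : f.1 u ∈ N := (hmk _).1 hz
            have : f.1 u - u = 0 := hinj _ (by
              rw [map_sub, f.2.2 _ ((hN _).1 hfu).1, sub_self])
            rw [hmk, ← sub_eq_zero.1 this]
            exact hfu
        map_app' := fun z => by
          obtain ⟨u, rfl⟩ := N.mkQ_surjective z
          exact (hQ' (f.1 u)).trans ((f.2.1 u).trans (hQ' u).symm) }
    exact ⟨⟨h, f.1, f.2.2, fun u => rfl⟩, rfl⟩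

end

end BinaryQuadraticForm

/-- Let `(V, q)` be a regular quadratic space over `F₂` and `W ⊆ V` a
subspace, `K_b = W ∩ W^⊥` and `K_q = {x ∈ K_b | q x = 0}`. With `w = dim W^⊥`,
`n = dim K_b`, `k = dim K_q`, the form `q` induces a quadratic form on `W^⊥/K_q` and the
pointwise stabilizer of `W` in `O(V)` has order `#O(W^⊥/K_q) · 2^e` where
`e = n(n-1)/2 + k(w-n) + n - k`. -/
theorem order_pointwise_stabilizer (V : Type*) [AddCommGroup V] [Module (ZMod 2) V]
    [FiniteDimensional (ZMod 2) V]
    (Q : QuadraticForm (ZMod 2) V)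
    (hreg : LinearMap.BilinForm.Nondegenerate (QuadraticMap.polarBilin Q))
    (W : Submodule (ZMod 2) V) :
    ∃ (Kq : Submodule (ZMod 2) V)
      (hKq : Kq ≤ LinearMap.BilinForm.orthogonal (QuadraticMap.polarBilin Q) W)
      (Q' : QuadraticForm (ZMod 2)
        (↥(LinearMap.BilinForm.orthogonal (QuadraticMap.polarBilin Q) W) ⧸
          Submodule.comap
            (LinearMap.BilinForm.orthogonal (QuadraticMap.polarBilin Q) W).subtype Kq)),
      (∀ x : V, x ∈ Kq ↔
        (x ∈ W ⊓ LinearMap.BilinForm.orthogonal (QuadraticMap.polarBilin Q) W ∧ Q x = 0)) ∧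
      (∀ x : ↥(LinearMap.BilinForm.orthogonal (QuadraticMap.polarBilin Q) W),
        Q' (Submodule.Quotient.mk x) = Q (x : V)) ∧
      Nat.card {g : QuadraticMap.IsometryEquiv Q Q // ∀ x ∈ W, g x = x} =
        Nat.card (QuadraticMap.IsometryEquiv Q' Q') *
          2 ^ (Module.finrank (ZMod 2)
                ↥(W ⊓ LinearMap.BilinForm.orthogonal (QuadraticMap.polarBilin Q) W) *
              (Module.finrank (ZMod 2)
                ↥(W ⊓ LinearMap.BilinForm.orthogonal (QuadraticMap.polarBilin Q) W) - 1) / 2 +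
            Module.finrank (ZMod 2) ↥Kq *
              (Module.finrank (ZMod 2)
                  ↥(LinearMap.BilinForm.orthogonal (QuadraticMap.polarBilin Q) W) -
                Module.finrank (ZMod 2)
                  ↥(W ⊓ LinearMap.BilinForm.orthogonal (QuadraticMap.polarBilin Q) W)) +
            Module.finrank (ZMod 2)
              ↥(W ⊓ LinearMap.BilinForm.orthogonal (QuadraticMap.polarBilin Q) W) -
            Module.finrank (ZMod 2) ↥Kq) := by
  have hU : ∀ x, x ∈ LinearMap.BilinForm.orthogonal (QuadraticMap.polarBilin Q) W ↔
      ∀ y ∈ W, QuadraticMap.polar Q y x = 0 := fun x => LinearMap.BilinForm.mem_orthogonal_iff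
  have hUU : ∀ x, x ∈ W ↔ ∀ y ∈ LinearMap.BilinForm.orthogonal (QuadraticMap.polarBilin Q) W,
      QuadraticMap.polar Q y x = 0 := fun x => by
    have hrefl : (QuadraticMap.polarBilin Q).IsRefl := fun x y h =>
      (QuadraticMap.polar_comm Q y x).trans h
    conv_lhs => rw [← LinearMap.BilinForm.orthogonal_orthogonal hreg hrefl W]
    exact LinearMap.BilinForm.mem_orthogonal_iff
  generalize LinearMap.BilinForm.orthogonal (QuadraticMap.polarBilin Q) W = U at hU hUU ⊢
  let Kq : Submodule (ZMod 2) V :=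
    { carrier := {x | x ∈ W ⊓ U ∧ Q x = 0}
      zero_mem' := ⟨Submodule.zero_mem _, QuadraticMap.map_zero Q⟩
      add_mem' := fun {x y} hx hy => ⟨Submodule.add_mem _ hx.1 hy.1, by
        rw [QuadraticMap.map_add Q, hx.2, hy.2, (hU y).1 hy.1.2 x hx.1.1, add_zero, add_zero]⟩
      smul_mem' := fun c x hx => ⟨Submodule.smul_mem _ c hx.1, by
        rw [QuadraticMap.map_smul, hx.2, smul_zero]⟩ }
  have hKq : ∀ x, x ∈ Kq ↔ x ∈ W ⊓ U ∧ Q x = 0 := fun x => Iff.rfl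
  clear_value Kq
  have hKqU : Kq ≤ U := fun x hx => ((hKq x).1 hx).1.2
  have hKU : W ⊓ U ≤ U := inf_le_right
  obtain ⟨Q', hQ'⟩ := BinaryQuadraticForm.exists_quotient_form (Q := Q.comp U.subtype)
    (Kq.comap U.subtype) (fun z hz => ((hKq z).1 hz).2)
    (fun z hz x => (hUU z).1 ((hKq z).1 hz).1.1 x x.2)
  refine ⟨Kq, hKqU, Q', hKq, hQ', ?_⟩
  have hradical : ∀ x : U, x ∈ (W ⊓ U).comap U.subtype ↔
      ∀ y, QuadraticMap.polar (Q.comp U.subtype) y x = 0 := fun x =>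
    ⟨fun hx y => (hUU x).1 hx.1 y y.2, fun hx => ⟨(hUU x).2 fun y hy => hx ⟨y, hy⟩, x.2⟩⟩
  have hlifts := BinaryQuadraticForm.natCard_isometry_fixing_radical hradical
    (N := Kq.comap U.subtype) (fun x => hKq x) hQ'
  rw [(Submodule.comapSubtypeEquivOfLe hKqU).finrank_eq,
    (Submodule.comapSubtypeEquivOfLe hKU).finrank_eq] at hlifts
  have hrestrict := BinaryQuadraticForm.natCard_stabilizer_eq_mul hreg hU hUU
  have hfixing := BinaryQuadraticForm.natCard_fixing hreg (Y := W ⊔ U) (K := W ⊓ U) (Kq := Kq)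
    (fun x => ⟨fun hx y hy => by
      obtain ⟨w, hw, u, hu, rfl⟩ := Submodule.mem_sup.1 hy
      rw [QuadraticMap.polar_add_left, (hU x).1 hx.2 w hw, (hUU x).1 hx.1 u hu, add_zero],
      fun hx => ⟨(hUU x).2 fun y hy => hx y (Submodule.mem_sup_right hy),
        (hU x).2 fun y hy => hx y (Submodule.mem_sup_left hy)⟩⟩)
    (inf_le_left.trans le_sup_left) hKq
  have hset : Nat.card {f : U →ₗ[ZMod 2] U //
      (∀ x : U, Q (f x) = Q x) ∧ ∀ x : U, (x : V) ∈ W → f x = x} =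
      Nat.card {f : U →ₗ[ZMod 2] U // (∀ x, (Q.comp U.subtype) (f x) = (Q.comp U.subtype) x) ∧
        ∀ x ∈ (W ⊓ U).comap U.subtype, f x = x} := by
    simp
  have hle : Module.finrank (ZMod 2) Kq ≤ Module.finrank (ZMod 2) ↥(W ⊓ U) :=
    Submodule.finrank_mono fun x hx => ((hKq x).1 hx).1
  rw [hrestrict, hset, hlifts, hfixing, mul_assoc, ← pow_add]
  congr 2
  omega
end
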